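/- arXiv:2203.13798 — 2 statements merged into one kernel-verified Lean document; each statement's English description precedes it below -/
import Mathlib

section
/- For every integer n ≥ 2, the Higman–Thompson group V_n is not inner amenable; that is, there is no conjugation-invariant finitely additive probability measure defined on all subsets of V_n \ {1}. -/
noncomputable section

/-- The `n`-ary Cantor set `𝒞_n = {1,…,n}^ℕ`, with the product topology. -/
abbrev CantorN (n : ℕ) := ℕ → Fin n

/-- The group of self-homeomorphisms of a space, with `(f * g) x = f (g x)`. -/
instance {X : Type*} [TopologicalSpace X] : Group (X ≃ₜ X) where
  mul f g := g.trans f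
  one := Homeomorph.refl _
  inv := Homeomorph.symm
  mul_assoc _ _ _ := Homeomorph.ext fun _ => rfl
  one_mul _ := Homeomorph.ext fun _ => rfl
  mul_one _ := Homeomorph.ext fun _ => rfl
  inv_mul_cancel f := Homeomorph.ext f.symm_apply_apply

/-- Prepend a finite word `w` to an infinite sequence `κ`, giving `wκ`. -/
def prependWord {n : ℕ} (w : List (Fin n)) (κ : CantorN n) : CantorN n :=
  fun m => if h : m < w.length then w.get ⟨m, h⟩ else κ (m - w.length)

/-- The cone `𝒞_n(w)` of all infinite sequences with prefix `w`. -/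
def cone {n : ℕ} (w : List (Fin n)) : Set (CantorN n) := Set.range (prependWord w)

/-- Membership in the Higman–Thompson group `V_n`: `f` is a self-homeomorphism of `𝒞_n`
obtained by taking a partition of `𝒞_n` into finitely many cones `𝒞_n(w_1),…,𝒞_n(w_k)`,
another partition into the same number of cones `𝒞_n(v_1),…,𝒞_n(v_k)`, a bijection `σ` of
the indices, and mapping each `𝒞_n(w_i)` to `𝒞_n(v_{σ(i)})` by prefix replacement. -/
def VnMem (n : ℕ) (f : CantorN n ≃ₜ CantorN n) : Prop :=
  ∃ (k : ℕ) (w v : Fin k → List (Fin n)) (σ : Equiv.Perm (Fin k)),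
    (⋃ i, cone (w i)) = Set.univ ∧
    (Pairwise fun i j => Disjoint (cone (w i)) (cone (w j))) ∧
    (⋃ i, cone (v i)) = Set.univ ∧
    (Pairwise fun i j => Disjoint (cone (v i)) (cone (v j))) ∧
    ∀ (i : Fin k) (κ : CantorN n), f (prependWord (w i) κ) = prependWord (v (σ i)) κ

/-- The set `V_n \ {1}`, as a subtype. -/
def VnNontriv (n : ℕ) := {f : CantorN n ≃ₜ CantorN n // VnMem n f ∧ f ≠ 1}

open Filter Topology

theorem Homeo.mul_apply {X : Type*} [TopologicalSpace X] (f g : X ≃ₜ X) (x : X) :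
    (f * g) x = f (g x) := rfl

theorem Homeo.inv_apply_self {X : Type*} [TopologicalSpace X] (f : X ≃ₜ X) (x : X) :
    f⁻¹ (f x) = x := f.symm_apply_apply x

theorem Homeo.apply_inv_self {X : Type*} [TopologicalSpace X] (f : X ≃ₜ X) (x : X) :
    f (f⁻¹ x) = x := f.apply_symm_apply x

section NorthSouth

variable {X : Type*} [TopologicalSpace X]

/-- North-south dynamics: `c` has an attracting fixed point `p` and a repelling fixed point `q`. -/
structure NorthSouth (c : X ≃ₜ X) (p q : X) : Prop where
  ne : p ≠ q
  apply_left : c p = p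
  apply_right : c q = q
  tendsto_pow : ∀ x, x ≠ q → Tendsto (fun m : ℕ => (c ^ m) x) atTop (𝓝 p)
  tendsto_inv_pow : ∀ x, x ≠ p → Tendsto (fun m : ℕ => (c⁻¹ ^ m) x) atTop (𝓝 q)

theorem pow_apply_eq_self {c : X ≃ₜ X} {p : X} (h : c p = p) (m : ℕ) : (c ^ m) p = p := by
  induction m with
  | zero => rfl
  | succ m ih => rw [pow_succ, Homeo.mul_apply, h, ih]

theorem Commute.homeo_apply {f c : X ≃ₜ X} (h : Commute f c) (x : X) : f (c x) = c (f x) :=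
  congrArg (fun g : X ≃ₜ X => g x) h.eq

namespace NorthSouth

theorem symm {c : X ≃ₜ X} {p q : X} (h : NorthSouth c p q) : NorthSouth c⁻¹ q p where
  ne := h.ne.symm
  apply_left := by
    conv_lhs => rw [← h.apply_right]
    exact Homeo.inv_apply_self c q
  apply_right := by
    conv_lhs => rw [← h.apply_left]
    exact Homeo.inv_apply_self c p
  tendsto_pow := h.tendsto_inv_pow
  tendsto_inv_pow := by simpa only [inv_inv] using h.tendsto_pow

theorem conj {c : X ≃ₜ X} {p q : X} (h : NorthSouth c p q) (g : X ≃ₜ X) :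
    NorthSouth (g * c * g⁻¹) (g p) (g q) where
  ne := g.injective.ne h.ne
  apply_left := by
    rw [Homeo.mul_apply, Homeo.mul_apply, Homeo.inv_apply_self, h.apply_left]
  apply_right := by
    rw [Homeo.mul_apply, Homeo.mul_apply, Homeo.inv_apply_self, h.apply_right]
  tendsto_pow x hx := by
    have hx' : g⁻¹ x ≠ q := fun e => hx (by rw [← e, Homeo.apply_inv_self])
    simp only [conj_pow]
    exact (g.continuous.tendsto p).comp (h.tendsto_pow _ hx')
  tendsto_inv_pow x hx := by
    have hx' : g⁻¹ x ≠ p := fun e => hx (by rw [← e, Homeo.apply_inv_self])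
    simp only [conj_inv, conj_pow]
    exact (g.continuous.tendsto q).comp (h.tendsto_inv_pow _ hx')

variable [T2Space X]

theorem eq_or_eq_of_pow_apply {c : X ≃ₜ X} {p q x : X} (h : NorthSouth c p q) {j : ℕ} (hj : j ≠ 0)
    (hx : (c ^ j) x = x) : x = p ∨ x = q := by
  by_cases hq : x = q
  · exact Or.inr hq
  left
  have h1 : Tendsto (fun m : ℕ => j * m) atTop atTop :=
    tendsto_id.const_mul_atTop' (Nat.pos_of_ne_zero hj)
  have h2 := (h.tendsto_pow x hq).comp h1
  have h3 : (fun m : ℕ => (c ^ m) x) ∘ (fun m : ℕ => j * m) = fun _ => x := by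
    funext m
    simp only [Function.comp_apply, pow_mul, pow_apply_eq_self hx m]
  rw [h3] at h2
  exact tendsto_nhds_unique tendsto_const_nhds h2

theorem apply_left_of_commute [Infinite X] {c f : X ≃ₜ X} {p q : X} (h : NorthSouth c p q)
    (hf : Commute f c) : f p = p := by
  classical
  obtain ⟨x, hx⟩ := Infinite.exists_notMem_finset ({q, f⁻¹ q} : Finset X)
  simp only [Finset.mem_insert, Finset.mem_singleton, not_or] at hx
  have hfx : f x ≠ q := fun e => hx.2 (by rw [← e, Homeo.inv_apply_self])
  have h1 := (f.continuous.tendsto p).comp (h.tendsto_pow x hx.1)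
  have h2 : f ∘ (fun m : ℕ => (c ^ m) x) = fun m : ℕ => (c ^ m) (f x) := by
    funext m
    exact (hf.pow_right m).homeo_apply x
  rw [h2] at h1
  exact tendsto_nhds_unique h1 (h.tendsto_pow _ hfx)

theorem apply_right_of_commute [Infinite X] {c f : X ≃ₜ X} {p q : X} (h : NorthSouth c p q)
    (hf : Commute f c) : f q = q :=
  h.symm.apply_left_of_commute hf.inv_right

/-- If the fixed points of `f ≠ 1` accumulate only where `f` is locally trivial, and `f` commutes
with `c`, then every fixed point of `f` is fixed by `c`. -/
theorem eq_or_eq_of_commute [Infinite X] {c f : X ≃ₜ X} {p q x : X} (h : NorthSouth c p q)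
    (hf : Commute f c) (hf1 : f ≠ 1)
    (hgerm : ∀ (p : X) (u : ℕ → X), Tendsto u atTop (𝓝 p) → (∀ m, u m ≠ p) → (∀ m, f (u m) = u m) →
      f p = p → ∀ᶠ y in 𝓝 p, f y = y)
    (hx : f x = x) : x = p ∨ x = q := by
  by_contra! hne
  have hloc : ∀ᶠ y in 𝓝 p, f y = y := by
    refine hgerm p _ (h.tendsto_pow x hne.2) (fun m hm => hne.1 ?_) (fun m => ?_)
      (h.apply_left_of_commute hf)
    · exact (c ^ m).injective (hm.trans (pow_apply_eq_self h.apply_left m).symm)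
    · rw [(hf.pow_right m).homeo_apply, hx]
  refine hf1 (Homeomorph.ext fun y => ?_)
  by_cases hy : y = q
  · rw [hy]
    exact h.apply_right_of_commute hf
  obtain ⟨m, hm⟩ := ((h.tendsto_pow y hy).eventually hloc).exists
  rw [(hf.pow_right m).homeo_apply] at hm
  exact (c ^ m).injective hm

theorem apply_left_of_commute_of_commute [Infinite X] {c f k : X ≃ₜ X} {p q p' q' : X}
    (h : NorthSouth c p q) (hf : Commute f c) (hf1 : f ≠ 1)
    (hgerm : ∀ (p : X) (u : ℕ → X), Tendsto u atTop (𝓝 p) → (∀ m, u m ≠ p) → (∀ m, f (u m) = u m) →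
      f p = p → ∀ᶠ y in 𝓝 p, f y = y)
    (hk : NorthSouth k p' q') (hfk : Commute f k) : k p = p := by
  have hp : f (k p) = k p := by rw [hfk.homeo_apply, h.apply_left_of_commute hf]
  have hq : f (k q) = k q := by rw [hfk.homeo_apply, h.apply_right_of_commute hf]
  rcases h.eq_or_eq_of_commute hf hf1 hgerm hp with hp | hp
  · exact hp
  rcases h.eq_or_eq_of_commute hf hf1 hgerm hq with hq | hq
  · have h2 : (k ^ 2) p = p := by rw [pow_two, Homeo.mul_apply, hp, hq]
    rcases hk.eq_or_eq_of_pow_apply two_ne_zero h2 with e | e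
    · rw [e, hk.apply_left]
    · rw [e, hk.apply_right]
  · exact absurd (k.injective (hp.trans hq.symm)) h.ne

end NorthSouth

end NorthSouth

section Words

variable {n : ℕ}

theorem prependWord_nil (κ : CantorN n) : prependWord [] κ = κ := by
  funext m
  simp [prependWord]

theorem prependWord_append (w v : List (Fin n)) (κ : CantorN n) :
    prependWord (w ++ v) κ = prependWord w (prependWord v κ) := by
  funext m
  simp only [prependWord, List.length_append, List.get_eq_getElem, List.getElem_append]
  by_cases h1 : m < w.length
  · simp [h1, Nat.lt_add_right]
  · by_cases h2 : m - w.length < v.length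
    · have h3 : m < w.length + v.length := by omega
      simp [h1, h2, h3]
    · have h3 : ¬ m < w.length + v.length := by omega
      simp [h1, h2, h3, Nat.sub_sub]

theorem prependWord_of_lt (w : List (Fin n)) (κ : CantorN n) {m : ℕ} (h : m < w.length) :
    prependWord w κ m = w[m] := by
  simp [prependWord, h]

theorem prependWord_length_add (w : List (Fin n)) (κ : CantorN n) (m : ℕ) :
    prependWord w κ (w.length + m) = κ m := by
  simp [prependWord]

/-- The sequence obtained by deleting the first `k` letters. -/
def dropWord (k : ℕ) (x : CantorN n) : CantorN n := fun m => x (k + m)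

/-- The word formed by the first `k` letters. -/
def takeWord (k : ℕ) (x : CantorN n) : List (Fin n) := List.ofFn fun i : Fin k => x i

theorem length_takeWord (k : ℕ) (x : CantorN n) : (takeWord k x).length = k := by
  simp [takeWord]

theorem prependWord_takeWord_dropWord (k : ℕ) (x : CantorN n) :
    prependWord (takeWord k x) (dropWord k x) = x := by
  funext m
  by_cases h : m < k
  · rw [prependWord_of_lt _ _ (by simpa [takeWord] using h)]
    simp [takeWord]
  · simp only [prependWord, length_takeWord, h, dropWord, dite_false]
    congr 1
    omega

theorem dropWord_prependWord (w : List (Fin n)) (κ : CantorN n) :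
    dropWord w.length (prependWord w κ) = κ :=
  funext (prependWord_length_add w κ)

theorem takeWord_prependWord (w : List (Fin n)) (κ : CantorN n) :
    takeWord w.length (prependWord w κ) = w := by
  refine List.ext_getElem (by simp [takeWord]) fun i h1 h2 => ?_
  simp [takeWord, prependWord]

theorem mem_cone_iff {w : List (Fin n)} {x : CantorN n} :
    x ∈ cone w ↔ takeWord w.length x = w := by
  constructor
  · rintro ⟨κ, rfl⟩
    exact takeWord_prependWord w κ
  · intro h
    refine ⟨dropWord w.length x, ?_⟩
    conv_lhs => rw [← h]
    rw [length_takeWord, prependWord_takeWord_dropWord]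

theorem prependWord_mem_cone (w : List (Fin n)) (κ : CantorN n) : prependWord w κ ∈ cone w :=
  ⟨κ, rfl⟩

theorem eq_of_prependWord_eq {w v : List (Fin n)} {κ κ' : CantorN n}
    (h : prependWord w κ = prependWord v κ') (hl : w.length = v.length) : w = v := by
  rw [← takeWord_prependWord w κ, h, hl, takeWord_prependWord]

theorem exists_append_of_prependWord_eq {w v : List (Fin n)} {κ κ' : CantorN n}
    (h : prependWord w κ = prependWord v κ') (hl : v.length ≤ w.length) : ∃ s, w = v ++ s := by
  refine ⟨w.drop v.length, ?_⟩
  have h1 : w.take v.length = v := by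
    refine eq_of_prependWord_eq (κ := prependWord (w.drop v.length) κ) (κ' := κ') ?_ (by simpa)
    rw [← prependWord_append, List.take_append_drop, h]
  conv_lhs => rw [← List.take_append_drop v.length w, h1]

theorem disjoint_cone_of_length_eq {w v : List (Fin n)} (hl : w.length = v.length) (hne : w ≠ v) :
    Disjoint (cone w) (cone v) := by
  rw [Set.disjoint_left]
  rintro _ ⟨κ, rfl⟩ ⟨κ', h⟩
  exact hne (eq_of_prependWord_eq h.symm hl)

theorem isOpen_cone (w : List (Fin n)) : IsOpen (cone w) := by
  have : cone w = ⋂ i : Fin w.length, (fun x : CantorN n => x i) ⁻¹' {w[i]} := by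
    ext x
    simp only [mem_cone_iff, Set.mem_iInter, Set.mem_preimage, Set.mem_singleton_iff]
    constructor
    · intro h i
      have h2 : (takeWord w.length x)[i]'(by simp [length_takeWord]) = w[i] := by simp only [h]
      rw [← h2]
      simp [takeWord]
    · intro h
      refine List.ext_getElem (by simp [takeWord]) fun i h1 h2 => ?_
      simpa [takeWord] using h ⟨i, h2⟩
  rw [this]
  exact isOpen_iInter_of_finite fun i => (isOpen_discrete _).preimage (continuous_apply _)

theorem continuous_prependWord (w : List (Fin n)) : Continuous (prependWord w) := by
  refine continuous_pi fun m => ?_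
  unfold prependWord
  by_cases h : m < w.length
  · simp only [h, dite_true]
    exact continuous_const
  · simp only [h, dite_false]
    exact continuous_apply _

theorem continuous_dropWord (k : ℕ) : Continuous (dropWord (n := n) k) :=
  continuous_pi fun _ => continuous_apply _

theorem exists_prependWord_eq_self {w : List (Fin n)} (hw : w ≠ []) : ∃ p, prependWord w p = p := by
  have hpos : 0 < w.length := List.length_pos_iff.2 hw
  refine ⟨fun m => w[m % w.length]'(Nat.mod_lt _ hpos), ?_⟩
  funext m
  by_cases h : m < w.length
  · simp [prependWord, h, Nat.mod_eq_of_lt h]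
  · simp [prependWord, h, ← Nat.mod_eq_sub_mod (not_lt.1 h)]

theorem prependWord_apply_congr {w : List (Fin n)} (hw : w ≠ []) {x y : CantorN n} {k : ℕ}
    (h : ∀ i < k, x i = y i) : ∀ i < k + 1, prependWord w x i = prependWord w y i := by
  have hpos : 0 < w.length := List.length_pos_iff.2 hw
  intro i hi
  by_cases hl : i < w.length
  · simp [prependWord, hl]
  · simpa [prependWord, hl] using h _ (by omega)

theorem eq_of_prependWord_eq_prependWord {w v : List (Fin n)} (hl : w.length < v.length)
    {x y : CantorN n} (hx : prependWord w x = prependWord v x)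
    (hy : prependWord w y = prependWord v y) : x = y := by
  funext m
  induction m using Nat.strong_induction_on with
  | _ m ih =>
    rw [← prependWord_length_add w x m, ← prependWord_length_add w y m, hx, hy]
    by_cases h : w.length + m < v.length
    · simp [prependWord, h]
    · simpa [prependWord, h] using ih _ (by omega)

end Words

section Germs

variable {n : ℕ}

/-- `f` acts as a prefix replacement near every point. -/
def LocallyPrefixReplacing (f : CantorN n → CantorN n) : Prop :=
  ∀ x, ∃ w v : List (Fin n), x ∈ cone w ∧ ∀ κ, f (prependWord w κ) = prependWord v κ

theorem LocallyPrefixReplacing.comp {f g : CantorN n → CantorN n} (hg : LocallyPrefixReplacing g)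
    (hf : LocallyPrefixReplacing f) : LocallyPrefixReplacing (g ∘ f) := by
  intro x
  obtain ⟨w, v, ⟨κ₀, rfl⟩, hwv⟩ := hf x
  obtain ⟨w', v', ⟨κ₁, h₁⟩, hwv'⟩ := hg (f (prependWord w κ₀))
  have hκ : prependWord (takeWord w'.length κ₀) (dropWord w'.length κ₀) = κ₀ :=
    prependWord_takeWord_dropWord _ _
  set t := takeWord w'.length κ₀ with ht
  obtain ⟨s, hs⟩ : ∃ s, v ++ t = w' ++ s := by
    refine exists_append_of_prependWord_eq (κ := dropWord w'.length κ₀) (κ' := κ₁) ?_ ?_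
    · rw [prependWord_append, hκ, h₁, hwv]
    · simp [ht, length_takeWord]
  refine ⟨w ++ t, v' ++ s, ⟨dropWord w'.length κ₀, by rw [prependWord_append, hκ]⟩, fun κ => ?_⟩
  rw [Function.comp_apply, prependWord_append, hwv, ← prependWord_append, hs, prependWord_append,
    hwv', prependWord_append]

theorem LocallyPrefixReplacing.inv {f : CantorN n ≃ₜ CantorN n} (hf : LocallyPrefixReplacing f) :
    LocallyPrefixReplacing (f⁻¹ : CantorN n ≃ₜ CantorN n) := by
  intro x
  obtain ⟨w, v, ⟨κ₀, h₀⟩, hwv⟩ := hf (f⁻¹ x)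
  refine ⟨v, w, ⟨κ₀, by rw [← hwv, h₀, Homeo.apply_inv_self]⟩, fun κ => ?_⟩
  rw [← hwv, Homeo.inv_apply_self]

theorem VnMem.locallyPrefixReplacing {f : CantorN n ≃ₜ CantorN n} (hf : VnMem n f) :
    LocallyPrefixReplacing f := by
  obtain ⟨k, w, v, σ, hw, -, -, -, h⟩ := hf
  intro x
  obtain ⟨i, hi⟩ := Set.mem_iUnion.1 (hw.symm ▸ Set.mem_univ x : x ∈ ⋃ i, cone (w i))
  exact ⟨w i, v (σ i), hi, h i⟩

theorem LocallyPrefixReplacing.exists_uniform {f : CantorN n → CantorN n}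
    (hf : LocallyPrefixReplacing f) : ∃ N : ℕ, ∀ t : List (Fin n), t.length = N →
      ∃ v, ∀ κ, f (prependWord t κ) = prependWord v κ := by
  choose w v hw hwv using hf
  obtain ⟨F, hF⟩ := isCompact_univ.elim_finite_subcover (fun x => cone (w x))
    (fun x => isOpen_cone _) fun x _ => Set.mem_iUnion.2 ⟨x, hw x⟩
  refine ⟨F.sup fun x => (w x).length, fun t ht => ?_⟩
  rcases isEmpty_or_nonempty (CantorN n) with hE | ⟨⟨κ₀⟩⟩
  · exact ⟨[], fun κ => hE.elim κ⟩
  obtain ⟨x, hx, κ₁, h₁⟩ : ∃ x ∈ F, prependWord t κ₀ ∈ cone (w x) := by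
    simpa using hF (Set.mem_univ (prependWord t κ₀))
  obtain ⟨s, rfl⟩ := exists_append_of_prependWord_eq h₁.symm
    (ht ▸ Finset.le_sup (f := fun x => (w x).length) hx)
  exact ⟨v x ++ s, fun κ => by rw [prependWord_append, hwv, prependWord_append]⟩

theorem LocallyPrefixReplacing.vnMem {f : CantorN n ≃ₜ CantorN n} (hf : LocallyPrefixReplacing f) :
    VnMem n f := by
  obtain ⟨N, hN⟩ := hf.exists_uniform
  let e := Fintype.equivFin (Fin N → Fin n)
  let w : Fin (Fintype.card (Fin N → Fin n)) → List (Fin n) := fun i => List.ofFn (e.symm i)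
  have hlen : ∀ i, (w i).length = N := fun i => List.length_ofFn
  choose v hv using fun i => hN (w i) (hlen i)
  have himage : ∀ i, cone (v i) = f '' cone (w i) := fun i => by
    rw [cone, cone, ← Set.range_comp]
    exact congrArg Set.range (funext fun κ => (hv i κ).symm)
  have hunion : ⋃ i, cone (w i) = Set.univ := by
    refine Set.eq_univ_of_forall fun x => Set.mem_iUnion.2 ⟨e fun i => x i, ?_⟩
    refine ⟨dropWord N x, ?_⟩
    simp only [w, Equiv.symm_apply_apply]
    exact prependWord_takeWord_dropWord N x
  have hdisj : Pairwise fun i j => Disjoint (cone (w i)) (cone (w j)) := fun i j hij =>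
    disjoint_cone_of_length_eq ((hlen i).trans (hlen j).symm) fun h =>
      hij (e.symm.injective (List.ofFn_injective h))
  refine ⟨_, w, v, 1, hunion, hdisj, ?_, fun i j hij => ?_, hv⟩
  · simp only [himage, ← Set.image_iUnion, hunion, Set.image_univ, f.surjective.range_eq]
  · simp only [himage]
    exact (Set.disjoint_image_iff f.injective).2 (hdisj hij)

theorem vnMem_iff {f : CantorN n ≃ₜ CantorN n} : VnMem n f ↔ LocallyPrefixReplacing f :=
  ⟨VnMem.locallyPrefixReplacing, LocallyPrefixReplacing.vnMem⟩

/-- The Higman–Thompson group `V_n`. -/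
def higmanThompson (n : ℕ) : Subgroup (CantorN n ≃ₜ CantorN n) where
  carrier := {f | VnMem n f}
  mul_mem' hf hg := vnMem_iff.2 ((vnMem_iff.1 hf).comp (vnMem_iff.1 hg))
  one_mem' := vnMem_iff.2 fun x => ⟨[], [], ⟨x, prependWord_nil x⟩, fun _ => rfl⟩
  inv_mem' hf := vnMem_iff.2 (vnMem_iff.1 hf).inv

theorem mem_higmanThompson {f : CantorN n ≃ₜ CantorN n} : f ∈ higmanThompson n ↔ VnMem n f :=
  Iff.rfl

theorem LocallyPrefixReplacing.continuous {f : CantorN n → CantorN n}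
    (hf : LocallyPrefixReplacing f) : Continuous f := by
  refine continuous_iff_continuousAt.2 fun x => ?_
  obtain ⟨w, v, hx, hwv⟩ := hf x
  refine ContinuousAt.congr (f := fun y => prependWord v (dropWord w.length y))
    ((continuous_prependWord v).comp (continuous_dropWord _)).continuousAt ?_
  filter_upwards [(isOpen_cone w).mem_nhds hx]
  rintro _ ⟨κ, rfl⟩
  rw [dropWord_prependWord, hwv]

/-- An accumulation point of fixed points is an interior point of the fixed set. -/
theorem LocallyPrefixReplacing.eventually_fixed {f : CantorN n → CantorN n}
    (hf : LocallyPrefixReplacing f) {p : CantorN n} {u : ℕ → CantorN n}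
    (hu : Tendsto u atTop (𝓝 p)) (hne : ∀ m, u m ≠ p) (hfix : ∀ m, f (u m) = u m) (hp : f p = p) :
    ∀ᶠ y in 𝓝 p, f y = y := by
  obtain ⟨w, v, ⟨κ₀, rfl⟩, hwv⟩ := hf p
  obtain ⟨m, κ, hκ⟩ :=
    (hu.eventually ((isOpen_cone w).mem_nhds (prependWord_mem_cone w κ₀))).exists
  have hm := hfix m
  have hne := hne m
  rw [← hκ] at hm hne
  rw [hwv] at hm hp
  rcases lt_trichotomy w.length v.length with hl | hl | hl
  · exact absurd (congrArg _ (eq_of_prependWord_eq_prependWord hl hm.symm hp.symm)) hne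
  · obtain rfl := eq_of_prependWord_eq hp hl.symm
    filter_upwards [(isOpen_cone v).mem_nhds (prependWord_mem_cone v κ₀)]
    rintro _ ⟨κ', rfl⟩
    exact hwv κ'
  · exact absurd (congrArg _ (eq_of_prependWord_eq_prependWord hl hm hp)) hne

end Germs

section Generators

variable {n : ℕ}

open Classical in
/-- The map prepending `u` outside the cone of `w`, and deleting the prefix `w` on this cone, except
that it replaces the prefix `wu` by `uw`. -/
def stripWord (u w : List (Fin n)) (x : CantorN n) : CantorN n :=
  if x ∈ cone w then
    if dropWord w.length x ∈ cone u then
      prependWord (u ++ w) (dropWord (w.length + u.length) x)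
    else dropWord w.length x
  else prependWord u x

theorem stripWord_of_notMem (u : List (Fin n)) {w : List (Fin n)} {x : CantorN n}
    (h : x ∉ cone w) : stripWord u w x = prependWord u x := by
  simp [stripWord, h]

theorem stripWord_prependWord_of_notMem {u : List (Fin n)} (w : List (Fin n)) {κ : CantorN n}
    (h : κ ∉ cone u) : stripWord u w (prependWord w κ) = κ := by
  simp [stripWord, prependWord_mem_cone, dropWord_prependWord, h]

theorem stripWord_prependWord_append (u w : List (Fin n)) (κ : CantorN n) :
    stripWord u w (prependWord (w ++ u) κ) = prependWord (u ++ w) κ := by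
  have h : dropWord (w.length + u.length) (prependWord (w ++ u) κ) = κ := by
    rw [← List.length_append, dropWord_prependWord]
  rw [stripWord, h, prependWord_append, dropWord_prependWord]
  simp [prependWord_mem_cone]

theorem stripWord_cases (u w : List (Fin n)) (x : CantorN n) :
    x ∉ cone w ∨ (∃ κ, κ ∉ cone u ∧ x = prependWord w κ) ∨ ∃ κ, x = prependWord (w ++ u) κ := by
  by_cases h : x ∈ cone w
  · obtain ⟨κ, rfl⟩ := h
    by_cases h' : κ ∈ cone u
    · obtain ⟨κ, rfl⟩ := h'
      exact Or.inr (Or.inr ⟨κ, (prependWord_append _ _ _).symm⟩)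
    · exact Or.inr (Or.inl ⟨κ, h', rfl⟩)
  · exact Or.inl h

theorem stripWord_stripWord (u w : List (Fin n)) (x : CantorN n) :
    stripWord w u (stripWord u w x) = x := by
  rcases stripWord_cases u w x with h | ⟨κ, h, rfl⟩ | ⟨κ, rfl⟩
  · rw [stripWord_of_notMem u h, stripWord_prependWord_of_notMem u h]
  · rw [stripWord_prependWord_of_notMem w h, stripWord_of_notMem w h]
  · rw [stripWord_prependWord_append, stripWord_prependWord_append]

theorem locallyPrefixReplacing_stripWord (u w : List (Fin n)) :
    LocallyPrefixReplacing (stripWord u w) := by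
  have key : ∀ (v : List (Fin n)) (x : CantorN n), x ∉ cone v →
      ∀ κ, prependWord (takeWord v.length x) κ ∉ cone v := fun v x hx κ => by
    rw [mem_cone_iff] at hx ⊢
    have h := takeWord_prependWord (takeWord v.length x) κ
    rw [length_takeWord] at h
    rwa [h]
  intro x
  rcases stripWord_cases u w x with h | ⟨κ, h, rfl⟩ | ⟨κ, rfl⟩
  · refine ⟨takeWord w.length x, u ++ takeWord w.length x,
      ⟨dropWord w.length x, prependWord_takeWord_dropWord _ _⟩, fun κ => ?_⟩
    rw [stripWord_of_notMem u (key w x h κ), prependWord_append]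
  · refine ⟨w ++ takeWord u.length κ, takeWord u.length κ,
      ⟨dropWord u.length κ, by rw [prependWord_append, prependWord_takeWord_dropWord]⟩,
      fun κ' => ?_⟩
    rw [prependWord_append, stripWord_prependWord_of_notMem w (key u κ h κ')]
  · exact ⟨w ++ u, u ++ w, prependWord_mem_cone _ _, stripWord_prependWord_append u w⟩

/-- `stripWord` as a homeomorphism. -/
def stripHomeo (u w : List (Fin n)) : CantorN n ≃ₜ CantorN n where
  toFun := stripWord u w
  invFun := stripWord w u
  left_inv := stripWord_stripWord u w
  right_inv := stripWord_stripWord w u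
  continuous_toFun := (locallyPrefixReplacing_stripWord u w).continuous
  continuous_invFun := (locallyPrefixReplacing_stripWord w u).continuous

theorem stripHomeo_inv (u w : List (Fin n)) : (stripHomeo u w)⁻¹ = stripHomeo w u := rfl

theorem stripHomeo_apply_of_notMem (u : List (Fin n)) {w : List (Fin n)} {x : CantorN n}
    (h : x ∉ cone w) : stripHomeo u w x = prependWord u x :=
  stripWord_of_notMem u h

theorem stripHomeo_mem (u w : List (Fin n)) : stripHomeo u w ∈ higmanThompson n :=
  (locallyPrefixReplacing_stripWord u w).vnMem

end Generators

section PingPong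

variable {n : ℕ}

theorem tendsto_pow_of_prependWord {c : CantorN n ≃ₜ CantorN n} {U : List (Fin n)}
    {Q : Set (CantorN n)} {p x : CantorN n} (hU : U ≠ []) (hUQ : Disjoint (cone U) Q)
    (hc : ∀ x ∉ Q, c x = prependWord U x) (hp : prependWord U p = p) (hx : x ∉ Q) :
    Tendsto (fun m : ℕ => (c ^ m) x) atTop (𝓝 p) := by
  have key : ∀ m : ℕ, (c ^ m) x ∉ Q ∧ ∀ i < m, (c ^ m) x i = p i := by
    intro m
    induction m with
    | zero => exact ⟨hx, fun i hi => absurd hi (Nat.not_lt_zero i)⟩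
    | succ m ih =>
      rw [pow_succ', Homeo.mul_apply, hc _ ih.1]
      refine ⟨Set.disjoint_left.1 hUQ (prependWord_mem_cone _ _), ?_⟩
      rw [← hp]
      exact prependWord_apply_congr hU ih.2
  refine tendsto_pi_nhds.2 fun i => ?_
  refine tendsto_const_nhds.congr' ?_
  filter_upwards [eventually_gt_atTop i] with m hm
  exact ((key m).2 i hm).symm

theorem exists_pow_notMem {c : CantorN n ≃ₜ CantorN n} {U : List (Fin n)}
    {P Q : Set (CantorN n)} {q x : CantorN n} (hU : U ≠ []) (hPQ : Disjoint P Q)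
    (hc : ∀ x ∉ P, c⁻¹ x = prependWord U x) (hq : prependWord U q = q) (hx : x ≠ q) :
    ∃ m : ℕ, (c ^ m) x ∉ Q := by
  by_contra! h
  have hstep : ∀ j : ℕ, prependWord U ((c ^ (j + 1)) x) = (c ^ j) x := fun j => by
    rw [← hc _ (Set.disjoint_right.1 hPQ (h _)), pow_succ', Homeo.mul_apply, Homeo.inv_apply_self]
  have key : ∀ m j : ℕ, ∀ i < m, (c ^ j) x i = q i := by
    intro m
    induction m with
    | zero => exact fun j i hi => absurd hi (Nat.not_lt_zero i)
    | succ m ih =>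
      intro j
      rw [← hstep, ← hq]
      exact prependWord_apply_congr hU (ih (j + 1))
  exact hx (funext fun i => key (i + 1) 0 i (Nat.lt_succ_self i))

theorem exists_northSouth_of_prependWord {c : CantorN n ≃ₜ CantorN n} {U U' : List (Fin n)}
    {P Q : Set (CantorN n)} (hU : U ≠ []) (hU' : U' ≠ []) (hPQ : Disjoint P Q) (hUP : cone U ⊆ P)
    (hUQ : cone U' ⊆ Q) (hc : ∀ x ∉ Q, c x = prependWord U x)
    (hc' : ∀ x ∉ P, c⁻¹ x = prependWord U' x) : ∃ p q, NorthSouth c p q := by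
  obtain ⟨p, hp⟩ := exists_prependWord_eq_self hU
  obtain ⟨q, hq⟩ := exists_prependWord_eq_self hU'
  have hpP : p ∈ P := hUP ⟨p, hp⟩
  have hqQ : q ∈ Q := hUQ ⟨q, hq⟩
  have hpQ : p ∉ Q := Set.disjoint_left.1 hPQ hpP
  have hqP : q ∉ P := Set.disjoint_right.1 hPQ hqQ
  have shift : ∀ (d : CantorN n ≃ₜ CantorN n) (x r : CantorN n) (k : ℕ),
      Tendsto (fun m : ℕ => (d ^ m) ((d ^ k) x)) atTop (𝓝 r) →
      Tendsto (fun m : ℕ => (d ^ m) x) atTop (𝓝 r) := fun d x r k h => by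
    refine (tendsto_add_atTop_iff_nat k).1 (h.congr fun m => ?_)
    rw [pow_add, Homeo.mul_apply]
  refine ⟨p, q, fun h => hpQ (h ▸ hqQ), by rw [hc p hpQ, hp], ?_, fun x hx => ?_, fun x hx => ?_⟩
  · conv_lhs => rw [← hq, ← hc' q hqP, Homeo.apply_inv_self]
  · obtain ⟨k, hk⟩ := exists_pow_notMem hU' hPQ hc' hq hx
    exact shift c x p k (tendsto_pow_of_prependWord hU (hPQ.mono_left hUP) hc hp hk)
  · obtain ⟨k, hk⟩ := exists_pow_notMem (c := c⁻¹) hU hPQ.symm (by simpa only [inv_inv]) hp hx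
    exact shift c⁻¹ x q k (tendsto_pow_of_prependWord hU' (hPQ.symm.mono_left hUQ) hc' hq hk)

end PingPong

section FreeAction

variable {n : ℕ} [NeZero n]

/-- The binary digits, as letters of the alphabet. -/
def digit (n : ℕ) [NeZero n] (b : Bool) : Fin n := Fin.ofNat n b.toNat

/-- The two-letter word attached to a letter of the free group. -/
def letterWord (n : ℕ) [NeZero n] (s : Bool × Bool) : List (Fin n) := [digit n s.1, digit n s.2]

theorem digit_injective (hn : 2 ≤ n) : Function.Injective (digit n) := by
  intro b b' h
  have h0 := congrArg Fin.val h
  have h1 : b.toNat < n := lt_of_le_of_lt (Bool.toNat_le b) (by omega)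
  have h2 : b'.toNat < n := lt_of_le_of_lt (Bool.toNat_le b') (by omega)
  simp only [digit, Fin.ofNat, Nat.mod_eq_of_lt h1, Nat.mod_eq_of_lt h2] at h0
  cases b <;> cases b' <;> simp_all

theorem disjoint_cone_letterWord (hn : 2 ≤ n) {s t : Bool × Bool} (h : s ≠ t) :
    Disjoint (cone (letterWord n s)) (cone (letterWord n t)) := by
  refine disjoint_cone_of_length_eq rfl fun e => h ?_
  simp only [letterWord, List.cons.injEq, and_true] at e
  exact Prod.ext (digit_injective hn e.1) (digit_injective hn e.2)

/-- The inverse letter. -/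
def invLetter (s : Bool × Bool) : Bool × Bool := (s.1, !s.2)

/-- A free group of rank two of homeomorphisms of the Cantor set. -/
def freeHom (n : ℕ) [NeZero n] : FreeGroup Bool →* (CantorN n ≃ₜ CantorN n) :=
  FreeGroup.lift fun i => stripHomeo (letterWord n (i, true)) (letterWord n (i, false))

theorem freeHom_mem (g : FreeGroup Bool) : freeHom n g ∈ higmanThompson n := by
  have : (freeHom n).range ≤ higmanThompson n := by
    refine FreeGroup.range_lift_le ?_
    rintro _ ⟨i, rfl⟩
    exact stripHomeo_mem _ _
  exact this ⟨g, rfl⟩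

theorem freeHom_mk_singleton (s : Bool × Bool) :
    freeHom n (FreeGroup.mk [s]) = stripHomeo (letterWord n s) (letterWord n (invLetter s)) := by
  obtain ⟨i, b⟩ := s
  cases b <;> simp [freeHom, FreeGroup.lift_mk, invLetter, stripHomeo_inv]

theorem freeHom_mk_singleton_apply (s : Bool × Bool) {x : CantorN n}
    (hx : x ∉ cone (letterWord n (invLetter s))) :
    freeHom n (FreeGroup.mk [s]) x = prependWord (letterWord n s) x := by
  rw [freeHom_mk_singleton, stripHomeo_apply_of_notMem _ hx]

theorem freeHom_mk_apply (hn : 2 ≤ n) (s : Bool × Bool) (L : List (Bool × Bool))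
    (hL : FreeGroup.IsReduced (s :: L)) {x : CantorN n}
    (hx : x ∉ cone (letterWord n (invLetter ((s :: L).getLast (List.cons_ne_nil s L))))) :
    freeHom n (FreeGroup.mk (s :: L)) x = prependWord ((s :: L).flatMap (letterWord n)) x := by
  induction L generalizing s with
  | nil => simpa using freeHom_mk_singleton_apply s hx
  | cons t L ih =>
    rw [FreeGroup.isReduced_cons_cons] at hL
    have h1 : FreeGroup.mk (s :: t :: L) = FreeGroup.mk [s] * FreeGroup.mk (t :: L) := by
      rw [FreeGroup.mul_mk, List.singleton_append]
    rw [h1, map_mul, Homeo.mul_apply, ih t hL.2 (by simpa using hx), freeHom_mk_singleton_apply,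
      ← prependWord_append, List.flatMap_cons (x := s)]
    rw [List.flatMap_cons, prependWord_append]
    refine Set.disjoint_left.1 (disjoint_cone_letterWord hn fun e => ?_)
      (prependWord_mem_cone _ _)
    subst e
    simpa [invLetter] using hL.1

theorem exists_northSouth_of_isCyclicallyReduced (hn : 2 ≤ n) {L : List (Bool × Bool)}
    (hL : FreeGroup.IsCyclicallyReduced L) (hne : L ≠ []) :
    ∃ p q, NorthSouth (freeHom n (FreeGroup.mk L)) p q := by
  have hsub : ∀ (s : Bool × Bool) (L : List (Bool × Bool)),
      cone ((s :: L).flatMap (letterWord n)) ⊆ cone (letterWord n s) := by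
    rintro s L _ ⟨κ, rfl⟩
    rw [List.flatMap_cons, prependWord_append]
    exact prependWord_mem_cone _ _
  have hinvinv : ∀ s, invLetter (invLetter s) = s := fun s => by simp [invLetter]
  obtain ⟨s, L, rfl⟩ := List.exists_cons_of_ne_nil hne
  set t := (s :: L).getLast hne with ht
  have hinv : ∃ L', FreeGroup.invRev (s :: L) = invLetter t :: L' ∧
      (invLetter t :: L').getLast (List.cons_ne_nil _ _) = invLetter s := by
    obtain ⟨r, L', h⟩ := List.exists_cons_of_ne_nil
      (l := FreeGroup.invRev (s :: L)) (by simp [FreeGroup.invRev])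
    have h1 : r = invLetter t := by
      have := congrArg List.head? h
      rw [FreeGroup.invRev, List.head?_reverse, List.getLast?_map,
        List.getLast?_eq_getLast_of_ne_nil hne] at this
      exact (Option.some.inj this).symm
    have h2 : (r :: L').getLast (List.cons_ne_nil _ _) = invLetter s := by
      simp only [← h]
      simp [FreeGroup.invRev, invLetter]
    subst h1
    exact ⟨L', h, h2⟩
  obtain ⟨L', hL', hlast⟩ := hinv
  have hred : FreeGroup.IsReduced (invLetter t :: L') := by
    rw [← hL', FreeGroup.isReduced_iff_reduce_eq, FreeGroup.reduce_invRev, hL.1.reduce_eq]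
  refine exists_northSouth_of_prependWord (U := (s :: L).flatMap (letterWord n))
    (U' := (invLetter t :: L').flatMap (letterWord n)) (P := cone (letterWord n s))
    (Q := cone (letterWord n (invLetter t))) (by simp [letterWord]) (by simp [letterWord])
    (disjoint_cone_letterWord hn fun e => ?_) (hsub _ _) (hsub _ _)
    (fun x hx => freeHom_mk_apply hn s L hL.1 hx) (fun x hx => ?_)
  · have := hL.2 t (by simp [ht, List.getLast?_eq_getLast_of_ne_nil]) s (by simp)
    rw [e] at this
    simp [invLetter] at this
  · rw [← map_inv, FreeGroup.inv_mk, hL']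
    exact freeHom_mk_apply hn _ L' hred (by rwa [hlast, hinvinv])

theorem exists_northSouth_freeHom (hn : 2 ≤ n) {g : FreeGroup Bool} (hg : g ≠ 1) :
    ∃ p q, NorthSouth (freeHom n g) p q := by
  have h := FreeGroup.reduceCyclically.conj_conjugator_reduceCyclically g.toWord
  have hg' : g = FreeGroup.mk (FreeGroup.reduceCyclically.conjugator g.toWord) *
      FreeGroup.mk (FreeGroup.reduceCyclically g.toWord) *
      (FreeGroup.mk (FreeGroup.reduceCyclically.conjugator g.toWord))⁻¹ := by
    rw [FreeGroup.inv_mk, FreeGroup.mul_mk, FreeGroup.mul_mk, h, FreeGroup.mk_toWord]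
  have hne : FreeGroup.reduceCyclically g.toWord ≠ [] := fun e => hg (by
    rw [hg', e, ← FreeGroup.one_eq_mk, mul_one, mul_inv_cancel])
  obtain ⟨p, q, hpq⟩ := exists_northSouth_of_isCyclicallyReduced hn
    (FreeGroup.reduceCyclically.isCyclicallyReduced FreeGroup.isReduced_toWord) hne
  rw [hg', map_mul, map_mul, map_inv]
  exact ⟨_, _, hpq.conj _⟩

end FreeAction

section Mean

/-- An equivariant map exists as soon as each stabilizer in the source has a fixed point in the
target. -/
theorem exists_equivariant {G S X : Type*} [Group G] (ρ : G →* Equiv.Perm S)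
    (τ : G →* Equiv.Perm X) (h : ∀ s, ∃ x, ∀ g, ρ g s = s → τ g x = x) :
    ∃ ξ : S → X, ∀ g s, ξ (ρ g s) = τ g (ξ s) := by
  choose b hb using h
  let _ : MulAction G S := MulAction.compHom S ρ
  have hrep : ∀ s : S, ∃ g : G, ρ g (Quotient.out (Quotient.mk (MulAction.orbitRel G S) s)) = s :=
    fun s => (MulAction.orbitRel G S).symm (Quotient.mk_out (s := MulAction.orbitRel G S) s)
  choose γ hγ using hrep
  refine ⟨fun s => τ (γ s) (b (Quotient.out (Quotient.mk (MulAction.orbitRel G S) s))),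
    fun g s => ?_⟩
  have hq : Quotient.mk (MulAction.orbitRel G S) (ρ g s) = Quotient.mk _ s :=
    Quotient.sound (s := MulAction.orbitRel G S) ⟨g, rfl⟩
  have h1 := hγ (ρ g s)
  have h2 := hγ s
  simp only [hq] at h1 ⊢
  set r := Quotient.out (Quotient.mk (MulAction.orbitRel G S) s)
  have h3 : ρ ((g * γ s)⁻¹ * γ (ρ g s)) r = r := by
    rw [map_mul, Equiv.Perm.mul_apply, h1, map_inv, Equiv.Perm.inv_eq_iff_eq, map_mul,
      Equiv.Perm.mul_apply, h2]
  have h4 := hb r _ h3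
  rw [map_mul, Equiv.Perm.mul_apply, map_inv, Equiv.Perm.inv_eq_iff_eq, map_mul,
    Equiv.Perm.mul_apply] at h4
  exact h4

variable {n : ℕ} [NeZero n]

/-- The free group acting on the Cantor set admits no invariant finitely additive probability
measure. -/
theorem not_exists_invariant_freeHom (hn : 2 ≤ n) :
    ¬ ∃ ν : Set (CantorN n) → ℝ, (∀ A, 0 ≤ ν A) ∧ ν Set.univ = 1 ∧
      (∀ A B, Disjoint A B → ν (A ∪ B) = ν A + ν B) ∧ ∀ g A, ν (freeHom n g '' A) = ν A := by
  rintro ⟨ν, h0, h1, hadd, hinv⟩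
  have hmono : ∀ {A B}, A ⊆ B → ν A ≤ ν B := fun {A B} hAB => by
    rw [← Set.union_sdiff_cancel hAB, hadd _ _ Set.disjoint_sdiff_right]
    linarith [h0 (B \ A)]
  let P : Bool × Bool → Set (CantorN n) := fun s => cone (letterWord n s)
  have hP : ∀ {s t}, s ≠ t → Disjoint (P s) (P t) := disjoint_cone_letterWord hn
  have hpair : ∀ i, 1 ≤ ν (P (i, true)) + ν (P (i, false)) := fun i => by
    have h2 := hadd _ _ (disjoint_compl_right (a := P (i, false)))
    rw [Set.union_compl_self, h1] at h2
    have h3 : freeHom n (FreeGroup.mk [(i, true)]) '' (P (i, false))ᶜ ⊆ P (i, true) := by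
      rintro _ ⟨x, hx, rfl⟩
      rw [freeHom_mk_singleton_apply (i, true) hx]
      exact prependWord_mem_cone _ _
    have h4 := hmono h3
    rw [hinv] at h4
    linarith
  have hle := hmono (Set.subset_univ ((P (true, true) ∪ P (true, false)) ∪
    (P (false, true) ∪ P (false, false))))
  rw [hadd _ _ (by
      simp only [Set.disjoint_union_left, Set.disjoint_union_right]
      exact ⟨⟨hP (by simp), hP (by simp)⟩, hP (by simp), hP (by simp)⟩),
    hadd _ _ (hP (by simp)), hadd _ _ (hP (by simp)), h1] at hle
  linarith [hpair true, hpair false]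

/-- The conjugation action of the free group on the nontrivial elements of `V_n`. -/
def conjNontriv (n : ℕ) [NeZero n] : FreeGroup Bool →* Equiv.Perm (VnNontriv n) :=
  MonoidHom.toHomPerm
    { toFun := fun g f => ⟨freeHom n g * f.1 * (freeHom n g)⁻¹,
        mem_higmanThompson.1 (mul_mem (mul_mem (freeHom_mem g) (mem_higmanThompson.2 f.2.1))
          (inv_mem (freeHom_mem g))), fun h => f.2.2 (conj_eq_one_iff.1 h)⟩
      map_one' := funext fun f => Subtype.ext <| by
        change freeHom n 1 * f.1 * (freeHom n 1)⁻¹ = f.1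
        simp
      map_mul' := fun g h => funext fun f => Subtype.ext <| by
        change freeHom n (g * h) * f.1 * (freeHom n (g * h))⁻¹ =
          freeHom n g * (freeHom n h * f.1 * (freeHom n h)⁻¹) * (freeHom n g)⁻¹
        simp only [map_mul, mul_inv_rev, mul_assoc] }

theorem conjNontriv_apply (g : FreeGroup Bool) (f : VnNontriv n) :
    (conjNontriv n g f).1 = freeHom n g * f.1 * (freeHom n g)⁻¹ := rfl

/-- The action of the free group on the Cantor set by permutations. -/
def freePerm (n : ℕ) [NeZero n] : FreeGroup Bool →* Equiv.Perm (CantorN n) where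
  toFun g := (freeHom n g).toEquiv
  map_one' := by rw [map_one]; rfl
  map_mul' g h := by rw [map_mul]; rfl

theorem exists_fixed_of_conjNontriv (hn : 2 ≤ n) (f : VnNontriv n) :
    ∃ x, ∀ g, conjNontriv n g f = f → freeHom n g x = x := by
  have : Nontrivial (Fin n) := Fin.nontrivial_iff_two_le.2 hn
  have hcomm : ∀ g, conjNontriv n g f = f → Commute f.1 (freeHom n g) := fun g hg => by
    have h := congrArg Subtype.val hg
    rw [conjNontriv_apply, mul_inv_eq_iff_eq_mul] at h
    exact h.symm
  by_cases hstab : ∃ c, c ≠ 1 ∧ conjNontriv n c f = f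
  · obtain ⟨c, hc, hcf⟩ := hstab
    obtain ⟨p, q, hpq⟩ := exists_northSouth_freeHom hn hc
    refine ⟨p, fun g hg => ?_⟩
    by_cases hg1 : g = 1
    · rw [hg1, map_one]
      rfl
    obtain ⟨p', q', hpq'⟩ := exists_northSouth_freeHom hn hg1
    exact hpq.apply_left_of_commute_of_commute (hcomm c hcf) f.2.2
      (fun _ _ => (vnMem_iff.1 f.2.1).eventually_fixed) hpq' (hcomm g hg)
  · push Not at hstab
    refine ⟨fun _ => 0, fun g hg => ?_⟩
    rw [not_imp_not.1 (hstab g) hg, map_one]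
    rfl

end Mean

/-- **Non-inner amenability of `V_n`**: for every `n ≥ 2` there is no conjugation-invariant
finitely additive probability measure on the power set of `V_n \ {1}`. -/
theorem Vn_not_innerAmenable (n : ℕ) (hn : 2 ≤ n) :
    ¬ ∃ μ : Set (VnNontriv n) → ℝ,
      (∀ A, 0 ≤ μ A ∧ μ A ≤ 1) ∧
      μ Set.univ = 1 ∧
      (∀ A B, Disjoint A B → μ (A ∪ B) = μ A + μ B) ∧
      (∀ g : CantorN n ≃ₜ CantorN n, VnMem n g → ∀ A : Set (VnNontriv n),
        μ {x : VnNontriv n | ∃ h ∈ A, x.1 = g * h.1 * g⁻¹} = μ A) := by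
  rintro ⟨μ, hμ, h1, hadd, hinv⟩
  have : NeZero n := ⟨by omega⟩
  obtain ⟨ξ, hξ⟩ := exists_equivariant (conjNontriv n) (freePerm n) (exists_fixed_of_conjNontriv hn)
  refine not_exists_invariant_freeHom hn
    ⟨fun B => μ (ξ ⁻¹' B), fun B => (hμ _).1, by simpa using h1, fun A B hAB => ?_, fun g B => ?_⟩
  · exact hadd _ _ (hAB.preimage ξ)
  · change μ (ξ ⁻¹' (freeHom n g '' B)) = μ (ξ ⁻¹' B)
    rw [← hinv (freeHom n g) (freeHom_mem g) (ξ ⁻¹' B)]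
    congr 1
    ext x
    constructor
    · rintro ⟨y, hy, hyx⟩
      refine ⟨conjNontriv n g⁻¹ x, ?_, ?_⟩
      · rw [Set.mem_preimage, hξ, ← hyx]
        have : freePerm n g⁻¹ (freeHom n g y) = y := by
          change freeHom n g⁻¹ (freeHom n g y) = y
          rw [map_inv, Homeo.inv_apply_self]
        rwa [this]
      · rw [conjNontriv_apply, map_inv]
        group
    · rintro ⟨f, hf, hfx⟩
      have : x = conjNontriv n g f := Subtype.ext hfx
      rw [Set.mem_preimage, this, hξ]
      exact ⟨ξ f, hf, rfl⟩
end
end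

section
/- Fix an integer n ≥ 2. Define f : [0, 1/n] → [0, 1/n] by f(x) = n³x for 0 ≤ x ≤ (n³−1)/n⁷, f(x) = x + (n⁶−2n³+1)/n⁷ for (n³−1)/n⁷ ≤ x ≤ 1/n⁴, and f(x) = x/n³ + (n³−1)/n⁴ for 1/n⁴ ≤ x ≤ 1/n; and define h : [0, 1/n] → [1/n, 1] by h(x) = 1 − (n−1)x. Define a : ℝ/ℤ → ℝ/ℤ by a(x+ℤ) = f(x)+ℤ for 0 ≤ x ≤ 1/n and a(x+ℤ) = (h∘f∘h⁻¹)(x)+ℤ for 1/n ≤ x ≤ 1. Then a is a well-defined self-homeomorphism of ℝ/ℤ whose fixed points are exactly 0+ℤ and 1/n+ℤ; moreover 1/n+ℤ is an attracting fixed point of a and 0+ℤ is a repelling fixed point of a. -/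
noncomputable section

/-- The circle `S¹ = ℝ/ℤ`. -/
abbrev Circle1 := AddCircle (1 : ℝ)

/-- `x` is an attracting fixed point of `f`: it is fixed, and there is an open
neighborhood `U` of `x` such that the iterates of every point of `U` converge to `x`. -/
def IsAttractingFixedPt {X : Type*} [TopologicalSpace X] (f : X → X) (x : X) : Prop :=
  f x = x ∧ ∃ U : Set X, IsOpen U ∧ x ∈ U ∧
    ∀ y ∈ U, Filter.Tendsto (fun k => f^[k] y) Filter.atTop (nhds x)

/-- The piecewise linear map `f : [0, 1/n] → [0, 1/n]`:
`f(x) = n³x` on `[0, (n³−1)/n⁷]`, `f(x) = x + (n⁶−2n³+1)/n⁷` on `[(n³−1)/n⁷, 1/n⁴]`, and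
`f(x) = x/n³ + (n³−1)/n⁴` on `[1/n⁴, 1/n]`. -/
def pongF (n : ℕ) (x : ℝ) : ℝ :=
  if x ≤ ((n : ℝ) ^ 3 - 1) / (n : ℝ) ^ 7 then (n : ℝ) ^ 3 * x
  else if x ≤ 1 / (n : ℝ) ^ 4 then x + ((n : ℝ) ^ 6 - 2 * (n : ℝ) ^ 3 + 1) / (n : ℝ) ^ 7
  else x / (n : ℝ) ^ 3 + ((n : ℝ) ^ 3 - 1) / (n : ℝ) ^ 4

/-- The decreasing affine bijection `h : [0, 1/n] → [1/n, 1]`, `h(x) = 1 − (n−1)x`. -/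
def pongH (n : ℕ) (x : ℝ) : ℝ := 1 - ((n : ℝ) - 1) * x

/-- The inverse `h⁻¹ : [1/n, 1] → [0, 1/n]` of `pongH`, `h⁻¹(x) = (1 − x)/(n−1)`. -/
def pongHinv (n : ℕ) (x : ℝ) : ℝ := (1 - x) / ((n : ℝ) - 1)

open Filter Topology Set

/-- `pongF n` is the minimum of its three affine pieces. -/
theorem pongF_eq_min (n : ℕ) (hn : 2 ≤ n) (x : ℝ) :
    pongF n x = min (min ((n : ℝ) ^ 3 * x)
      (x + ((n : ℝ) ^ 6 - 2 * (n : ℝ) ^ 3 + 1) / (n : ℝ) ^ 7))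
      (x / (n : ℝ) ^ 3 + ((n : ℝ) ^ 3 - 1) / (n : ℝ) ^ 4) := by
  have hN : (2 : ℝ) ≤ n := by exact_mod_cast hn
  have hm : (1 : ℝ) < (n : ℝ) ^ 3 := one_lt_pow₀ (by linarith) (by norm_num)
  obtain ⟨m, hm_def⟩ : ∃ m : ℝ, m = (n : ℝ) ^ 3 := ⟨_, rfl⟩
  obtain ⟨u, hu_def⟩ : ∃ u : ℝ, u = 1 / (n : ℝ) ^ 7 := ⟨_, rfl⟩
  have hu : 0 < u := by rw [hu_def]; positivity
  have e1 : ((n : ℝ) ^ 3 - 1) / (n : ℝ) ^ 7 = (m - 1) * u := by rw [hm_def, hu_def]; ring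
  have e2 : ((n : ℝ) ^ 6 - 2 * (n : ℝ) ^ 3 + 1) / (n : ℝ) ^ 7 = (m - 1) ^ 2 * u := by
    rw [hm_def, hu_def]; ring
  have e3 : 1 / (n : ℝ) ^ 4 = m * u := by rw [hm_def, hu_def]; field_simp
  have e4 : ((n : ℝ) ^ 3 - 1) / (n : ℝ) ^ 4 = m * (m - 1) * u := by
    rw [hm_def, hu_def]; field_simp
  rw [← hm_def] at hm
  obtain ⟨t, ht⟩ : ∃ t : ℝ, t = x / m := ⟨_, rfl⟩
  have hx : x = m * t := by rw [ht]; field_simp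
  rw [pongF, e1, e2, e3, e4, ← hm_def, ← ht]
  split_ifs with h1 h2
  · have ht1 : t ≤ u := by nlinarith
    have k1 : (m - 1) * x ≤ (m - 1) * ((m - 1) * u) :=
      mul_le_mul_of_nonneg_left h1 (by linarith)
    have k2 : (m - 1) * t ≤ (m - 1) * u := mul_le_mul_of_nonneg_left ht1 (by linarith)
    rw [min_eq_left (a := m * x) (by nlinarith), min_eq_left (by nlinarith)]
  · have ht1 : t ≤ u := by nlinarith
    have k1 : (m - 1) * ((m - 1) * u) ≤ (m - 1) * x :=
      mul_le_mul_of_nonneg_left (not_le.1 h1).le (by linarith)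
    have k2 : (m - 1) * t ≤ (m - 1) * u := mul_le_mul_of_nonneg_left ht1 (by linarith)
    rw [min_eq_right (a := m * x) (by nlinarith), min_eq_left (by nlinarith)]
  · have ht1 : u ≤ t := by nlinarith
    have k1 : (m - 1) * ((m - 1) * u) ≤ (m - 1) * x :=
      mul_le_mul_of_nonneg_left (not_le.1 h1).le (by linarith)
    have k2 : (m - 1) * u ≤ (m - 1) * t := mul_le_mul_of_nonneg_left ht1 (by linarith)
    rw [min_eq_right (a := m * x) (by nlinarith), min_eq_right (by nlinarith)]

theorem pongF_continuous (n : ℕ) (hn : 2 ≤ n) : Continuous (pongF n) := by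
  rw [funext (pongF_eq_min n hn)]
  fun_prop

theorem pongF_strictMono (n : ℕ) (hn : 2 ≤ n) : StrictMono (pongF n) := by
  have hn0 : (0 : ℝ) < n := by exact_mod_cast (by omega : 0 < n)
  intro x y hxy
  rw [pongF_eq_min n hn, pongF_eq_min n hn]
  refine min_lt_min (min_lt_min ?_ ?_) ?_ <;> gcongr

theorem pongF_zero (n : ℕ) (hn : 2 ≤ n) : pongF n 0 = 0 := by
  have hN : (2 : ℝ) ≤ n := by exact_mod_cast hn
  have hm : (1 : ℝ) < (n : ℝ) ^ 3 := one_lt_pow₀ (by linarith) (by norm_num)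
  rw [pongF, if_pos (div_nonneg (by linarith) (by positivity)), mul_zero]

theorem pongF_one_div (n : ℕ) (hn : 2 ≤ n) : pongF n (1 / n) = 1 / n := by
  have hN : (2 : ℝ) ≤ n := by exact_mod_cast hn
  have hm : (1 : ℝ) < (n : ℝ) ^ 3 := one_lt_pow₀ (by linarith) (by norm_num)
  have h1 : (1 / n : ℝ) / (n : ℝ) ^ 3 + ((n : ℝ) ^ 3 - 1) / (n : ℝ) ^ 4 = 1 / n := by
    field_simp
    ring
  rw [pongF_eq_min n hn, h1]
  refine min_eq_right (le_min (le_mul_of_one_le_left (by positivity) hm.le) ?_)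
  have : (0 : ℝ) ≤ ((n : ℝ) ^ 6 - 2 * (n : ℝ) ^ 3 + 1) / (n : ℝ) ^ 7 :=
    div_nonneg (by nlinarith [sq_nonneg ((n : ℝ) ^ 3 - 1)]) (by positivity)
  linarith

theorem lt_pongF (n : ℕ) (hn : 2 ≤ n) {x : ℝ} (h0 : 0 < x) (h1 : x < 1 / n) :
    x < pongF n x := by
  have hN : (2 : ℝ) ≤ n := by exact_mod_cast hn
  have hm : (1 : ℝ) < (n : ℝ) ^ 3 := one_lt_pow₀ (by linarith) (by norm_num)
  rw [pongF_eq_min n hn]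
  refine lt_min (lt_min (lt_mul_of_one_lt_left h0 hm) ?_) ?_
  · have : (0 : ℝ) < ((n : ℝ) ^ 6 - 2 * (n : ℝ) ^ 3 + 1) / (n : ℝ) ^ 7 :=
      div_pos (by nlinarith [pow_pos (sub_pos.2 hm) 2]) (by positivity)
    linarith
  · have h2 : x / (n : ℝ) ^ 3 + ((n : ℝ) ^ 3 - 1) / (n : ℝ) ^ 4 - x
        = ((n : ℝ) ^ 3 - 1) / (n : ℝ) ^ 3 * (1 / n - x) := by
      field_simp
      ring
    have h3 : 0 < ((n : ℝ) ^ 3 - 1) / (n : ℝ) ^ 3 * (1 / n - x) :=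
      mul_pos (div_pos (by linarith) (by positivity)) (by linarith)
    linarith

/-- The conjugate of `pongF n` by `pongH n`, acting on `[1/n, 1]`. -/
def pongFConj (n : ℕ) (x : ℝ) : ℝ := pongH n (pongF n (pongHinv n x))

theorem pongFConj_continuous (n : ℕ) (hn : 2 ≤ n) : Continuous (pongFConj n) := by
  have := pongF_continuous n hn
  unfold pongFConj pongH pongHinv
  fun_prop

theorem pongFConj_strictMono (n : ℕ) (hn : 2 ≤ n) : StrictMono (pongFConj n) := by
  have hN : (0 : ℝ) < n - 1 := by
    have : (2 : ℝ) ≤ n := by exact_mod_cast hn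
    linarith
  intro x y hxy
  have h1 : pongHinv n y < pongHinv n x := by
    unfold pongHinv
    gcongr
  have h2 := mul_lt_mul_of_pos_left (pongF_strictMono n hn h1) hN
  unfold pongFConj pongH
  linarith

theorem pongHinv_one_div (n : ℕ) (hn : 2 ≤ n) : pongHinv n (1 / n) = 1 / n := by
  have hN : (2 : ℝ) ≤ n := by exact_mod_cast hn
  have hN' : (n : ℝ) - 1 ≠ 0 := by linarith
  unfold pongHinv
  field_simp

theorem pongFConj_one_div (n : ℕ) (hn : 2 ≤ n) : pongFConj n (1 / n) = 1 / n := by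
  have hN : (2 : ℝ) ≤ n := by exact_mod_cast hn
  rw [pongFConj, pongHinv_one_div n hn, pongF_one_div n hn, pongH]
  field_simp
  ring

theorem pongFConj_one (n : ℕ) (hn : 2 ≤ n) : pongFConj n 1 = 1 := by
  simp [pongFConj, pongHinv, pongH, pongF_zero n hn]

theorem pongFConj_lt (n : ℕ) (hn : 2 ≤ n) {x : ℝ} (h0 : 1 / n < x) (h1 : x < 1) :
    pongFConj n x < x := by
  have hN : (0 : ℝ) < n - 1 := by
    have : (2 : ℝ) ≤ n := by exact_mod_cast hn
    linarith
  have h2 : 0 < pongHinv n x := div_pos (by linarith) hN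
  have h3 : pongHinv n x < 1 / n := by
    rw [← pongHinv_one_div n hn]
    unfold pongHinv
    gcongr
  have h4 := mul_lt_mul_of_pos_left (lt_pongF n hn h2 h3) hN
  have h5 : (n - 1 : ℝ) * pongHinv n x = 1 - x := mul_div_cancel₀ _ hN.ne'
  unfold pongFConj pongH
  linarith

/-- The piecewise map on `[0, 1]` which induces the circle homeomorphism. -/
def pingpongUnit (n : ℕ) (x : ℝ) : ℝ := if x ≤ 1 / n then pongF n x else pongFConj n x

theorem pingpongUnit_of_le (n : ℕ) {x : ℝ} (hx : x ≤ 1 / n) : pingpongUnit n x = pongF n x :=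
  if_pos hx

theorem pingpongUnit_of_ge (n : ℕ) (hn : 2 ≤ n) {x : ℝ} (hx : 1 / n ≤ x) :
    pingpongUnit n x = pongFConj n x := by
  rcases hx.eq_or_lt with rfl | hx
  · rw [pingpongUnit_of_le n le_rfl, pongF_one_div n hn, pongFConj_one_div n hn]
  · exact if_neg hx.not_ge

theorem pingpongUnit_continuous (n : ℕ) (hn : 2 ≤ n) : Continuous (pingpongUnit n) :=
  (pongF_continuous n hn).if_le (pongFConj_continuous n hn) continuous_id continuous_const
    (by rintro x rfl; rw [pongF_one_div n hn, pongFConj_one_div n hn])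

theorem pingpongUnit_strictMono (n : ℕ) (hn : 2 ≤ n) : StrictMono (pingpongUnit n) := by
  refine StrictMonoOn.Iic_union_Ici (a := (1 / n : ℝ)) ?_ ?_
  · exact ((pongF_strictMono n hn).strictMonoOn _).congr
      fun x hx => (pingpongUnit_of_le n hx).symm
  · exact ((pongFConj_strictMono n hn).strictMonoOn _).congr
      fun x hx => (pingpongUnit_of_ge n hn hx).symm

theorem one_div_natCast_mem_Ioo (n : ℕ) (hn : 2 ≤ n) : (1 / n : ℝ) ∈ Ioo (0 : ℝ) 1 := by
  have hN : (2 : ℝ) ≤ n := by exact_mod_cast hn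
  exact ⟨by positivity, by rw [div_lt_one (by linarith)]; linarith⟩

theorem pingpongUnit_zero (n : ℕ) (hn : 2 ≤ n) : pingpongUnit n 0 = 0 := by
  rw [pingpongUnit_of_le n (one_div_natCast_mem_Ioo n hn).1.le, pongF_zero n hn]

theorem pingpongUnit_one (n : ℕ) (hn : 2 ≤ n) : pingpongUnit n 1 = 1 := by
  rw [pingpongUnit_of_ge n hn (one_div_natCast_mem_Ioo n hn).2.le, pongFConj_one n hn]

/-- Extend `g : [0, 1] → [0, 1]` to a map of the line commuting with integer translations. -/
def floorExtend (g : ℝ → ℝ) (x : ℝ) : ℝ := ⌊x⌋ + g (Int.fract x)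

theorem floorExtend_add_one (g : ℝ → ℝ) (x : ℝ) :
    floorExtend g (x + 1) = floorExtend g x + 1 := by
  simp only [floorExtend, Int.floor_add_one, Int.fract_add_one]
  push_cast
  ring

theorem floorExtend_of_mem_Ico (g : ℝ → ℝ) {x : ℝ} (hx : x ∈ Ico (0 : ℝ) 1) :
    floorExtend g x = g x := by
  have h1 : Int.fract x = x := Int.fract_eq_self.2 hx
  have h2 : ⌊x⌋ = 0 := Int.floor_eq_zero_iff.2 hx
  simp [floorExtend, h1, h2]

theorem floorExtend_of_mem_Icc {g : ℝ → ℝ} (h0 : g 0 = 0) (h1 : g 1 = 1) {x : ℝ}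
    (hx : x ∈ Icc (0 : ℝ) 1) : floorExtend g x = g x := by
  rcases hx.2.eq_or_lt with rfl | hlt
  · simp [floorExtend, h0, h1]
  · exact floorExtend_of_mem_Ico g ⟨hx.1, hlt⟩

theorem floorExtend_strictMono {g : ℝ → ℝ} (hg : StrictMono g) (h0 : g 0 = 0) (h1 : g 1 = 1) :
    StrictMono (floorExtend g) := by
  intro x y hxy
  rcases (Int.floor_mono hxy.le).eq_or_lt with h | h
  · have hfract : Int.fract x < Int.fract y := by
      rw [Int.fract, Int.fract, h]
      linarith
    have := hg hfract
    simp only [floorExtend, h]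
    linarith
  · have hx : g (Int.fract x) < 1 := h1 ▸ hg (Int.fract_lt_one x)
    have hy : 0 ≤ g (Int.fract y) := h0 ▸ hg.monotone (Int.fract_nonneg y)
    have h' : (⌊x⌋ : ℝ) + 1 ≤ ⌊y⌋ := by exact_mod_cast h
    simp only [floorExtend]
    linarith

theorem floorExtend_surjective {g : ℝ → ℝ} (hg : Continuous g) (h0 : g 0 = 0) (h1 : g 1 = 1) :
    Function.Surjective (floorExtend g) := by
  intro y
  have hy : Int.fract y ∈ Ico (g 0) (g 1) := by
    rw [h0, h1]
    exact ⟨Int.fract_nonneg y, Int.fract_lt_one y⟩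
  obtain ⟨t, ht, hty⟩ := intermediate_value_Ico zero_le_one hg.continuousOn hy
  refine ⟨⌊y⌋ + t, ?_⟩
  have hf : ⌊(⌊y⌋ : ℝ) + t⌋ = ⌊y⌋ := by
    rw [Int.floor_intCast_add, Int.floor_eq_zero_iff.2 ht, add_zero]
  have hr : Int.fract ((⌊y⌋ : ℝ) + t) = t := by
    rw [Int.fract_intCast_add, Int.fract_eq_self.2 ht]
  rw [floorExtend, hf, hr, hty, Int.floor_add_fract]

/-- The extension of a strictly increasing self-map of `[0, 1]`, as an order isomorphism. -/
def floorExtendOrderIso (g : ℝ → ℝ) (hg : StrictMono g) (hc : Continuous g) (h0 : g 0 = 0)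
    (h1 : g 1 = 1) : ℝ ≃o ℝ :=
  (floorExtend_strictMono hg h0 h1).orderIsoOfSurjective _ (floorExtend_surjective hc h0 h1)

theorem OrderIso.symm_add_one (G : ℝ ≃o ℝ) (hG : ∀ x, G (x + 1) = G x + 1) (x : ℝ) :
    G.symm (x + 1) = G.symm x + 1 := by
  rw [OrderIso.symm_apply_eq, hG, OrderIso.apply_symm_apply]

/-- The circle map induced by a degree one order isomorphism of the line. -/
def circleLiftMap (G : ℝ ≃o ℝ) (hG : ∀ x, G (x + 1) = G x + 1) : Circle1 → Circle1 :=
  Function.Periodic.lift (f := fun x : ℝ => (G x : Circle1)) (c := 1) fun x => by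
    simp only [hG, AddCircle.coe_add_period]

theorem circleLiftMap_coe (G : ℝ ≃o ℝ) (hG : ∀ x, G (x + 1) = G x + 1) (x : ℝ) :
    circleLiftMap G hG (x : Circle1) = (G x : Circle1) :=
  rfl

theorem circleLiftMap_continuous (G : ℝ ≃o ℝ) (hG : ∀ x, G (x + 1) = G x + 1) :
    Continuous (circleLiftMap G hG) :=
  continuous_coinduced_dom.2 ((AddCircle.continuous_mk' 1).comp G.continuous)

/-- The circle homeomorphism induced by a degree one order isomorphism of the line. -/
def circleHomeomorph (G : ℝ ≃o ℝ) (hG : ∀ x, G (x + 1) = G x + 1) : Circle1 ≃ₜ Circle1 where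
  toFun := circleLiftMap G hG
  invFun := circleLiftMap G.symm (G.symm_add_one hG)
  left_inv y := by
    induction y using QuotientAddGroup.induction_on with
    | H x => rw [circleLiftMap_coe, circleLiftMap_coe, OrderIso.symm_apply_apply]
  right_inv y := by
    induction y using QuotientAddGroup.induction_on with
    | H x => rw [circleLiftMap_coe, circleLiftMap_coe, OrderIso.apply_symm_apply]
  continuous_toFun := circleLiftMap_continuous G hG
  continuous_invFun := circleLiftMap_continuous _ _

/-- If a continuous map increases the points of `(p, q)` and keeps them below its fixed point
`q`, their iterates converge to `q`. -/
theorem tendsto_iterate_of_lt_map {T : ℝ → ℝ} (hT : Continuous T) {p q : ℝ}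
    (h : ∀ x ∈ Ioo p q, x < T x ∧ T x < q) {x : ℝ} (hx : x ∈ Ioo p q) :
    Tendsto (fun k => T^[k] x) atTop (𝓝 q) := by
  have hmem : ∀ k, T^[k] x ∈ Ioo p q := by
    intro k
    induction k with
    | zero => exact hx
    | succ k ih =>
      rw [Function.iterate_succ_apply']
      exact ⟨ih.1.trans (h _ ih).1, (h _ ih).2⟩
  have hmono : Monotone fun k => T^[k] x := monotone_nat_of_le_succ fun k => by
    rw [Function.iterate_succ_apply']
    exact (h _ (hmem k)).1.le
  have hbdd : BddAbove (range fun k => T^[k] x) :=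
    ⟨q, by rintro _ ⟨k, rfl⟩; exact (hmem k).2.le⟩
  have hlim := tendsto_atTop_ciSup hmono hbdd
  have hfix := isFixedPt_of_tendsto_iterate hlim hT.continuousAt
  have hp : p < ⨆ k, T^[k] x := hx.1.trans_le (le_ciSup hbdd 0)
  have hq : ⨆ k, T^[k] x ≤ q := ciSup_le fun k => (hmem k).2.le
  rcases hq.eq_or_lt with hq | hq
  · rwa [hq] at hlim
  · exact absurd hfix (h _ ⟨hp, hq⟩).1.ne'

theorem tendsto_iterate_of_map_lt {T : ℝ → ℝ} (hT : Continuous T) {q r : ℝ}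
    (h : ∀ x ∈ Ioo q r, T x < x ∧ q < T x) {x : ℝ} (hx : x ∈ Ioo q r) :
    Tendsto (fun k => T^[k] x) atTop (𝓝 q) := by
  have hS : Continuous fun y => -T (-y) := (hT.comp continuous_neg).neg
  have hiter : ∀ k, (fun y => -T (-y))^[k] (-x) = -T^[k] x := by
    have hsemi : Function.Semiconj Neg.neg T fun y => -T (-y) := fun y => by simp
    exact fun k => ((hsemi.iterate_right k) x).symm
  have := tendsto_iterate_of_lt_map hS (p := -r) (q := -q) (x := -x)
    (fun y hy => by
      have := h (-y) ⟨by linarith [hy.2], by linarith [hy.1]⟩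
      exact ⟨by linarith [this.1], by linarith [this.2]⟩)
    ⟨by linarith [hx.2], by linarith [hx.1]⟩
  simp only [hiter] at this
  simpa using this.neg

/-- A fixed point of the lift that attracts a neighbourhood projects to an attracting fixed
point of the circle map. -/
theorem isAttractingFixedPt_circleHomeomorph (G : ℝ ≃o ℝ) (hG : ∀ x, G (x + 1) = G x + 1)
    {p q r : ℝ} (hp : p < q) (hr : q < r) (hq : G q = q) (hlt : ∀ x ∈ Ioo p q, x < G x)
    (hgt : ∀ x ∈ Ioo q r, G x < x) :
    IsAttractingFixedPt (circleHomeomorph G hG) (q : Circle1) := by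
  have hcoe : ∀ x : ℝ, circleHomeomorph G hG (x : Circle1) = (G x : Circle1) := fun _ => rfl
  refine ⟨by rw [hcoe, hq], (fun x : ℝ => (x : Circle1)) '' Ioo p r,
    QuotientAddGroup.isOpenMap_coe _ isOpen_Ioo, ⟨q, ⟨hp, hr⟩, rfl⟩, ?_⟩
  rintro _ ⟨x, hx, rfl⟩
  have hsemi : Function.Semiconj (fun x : ℝ => (x : Circle1)) G (circleHomeomorph G hG) :=
    fun x => (hcoe x).symm
  have hiter : ∀ k, (circleHomeomorph G hG)^[k] (x : Circle1) = (G^[k] x : ℝ) :=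
    fun k => ((hsemi.iterate_right k) x).symm
  simp only [hiter]
  refine ((AddCircle.continuous_mk' 1).tendsto q).comp ?_
  rcases lt_trichotomy x q with h | rfl | h
  · exact tendsto_iterate_of_lt_map G.continuous
      (fun y hy => ⟨hlt y hy, hq ▸ G.strictMono hy.2⟩) ⟨hx.1, h⟩
  · simp only [Function.iterate_fixed hq]
    exact tendsto_const_nhds
  · exact tendsto_iterate_of_map_lt G.continuous
      (fun y hy => ⟨hgt y hy, hq ▸ G.strictMono hy.1⟩) ⟨h, hx.2⟩

/-- There is a well-defined self-homeomorphism `a` of `ℝ/ℤ` given by `a(x+ℤ) = f(x)+ℤ` for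
`0 ≤ x ≤ 1/n` and `a(x+ℤ) = (h∘f∘h⁻¹)(x)+ℤ` for `1/n ≤ x ≤ 1`; its fixed points are
exactly `0+ℤ` and `1/n+ℤ`, the point `1/n+ℤ` is an attracting fixed point of `a`, and
`0+ℤ` is a repelling fixed point of `a` (i.e. an attracting fixed point of `a⁻¹`). -/
theorem exists_pingpong_homeomorph (n : ℕ) (hn : 2 ≤ n) :
    ∃ a : Circle1 ≃ₜ Circle1,
      (∀ x : ℝ, 0 ≤ x → x ≤ 1 / n → a ((x : ℝ) : Circle1) = ((pongF n x : ℝ) : Circle1)) ∧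
      (∀ x : ℝ, 1 / n ≤ x → x ≤ 1 →
        a ((x : ℝ) : Circle1) = ((pongH n (pongF n (pongHinv n x)) : ℝ) : Circle1)) ∧
      (∀ y : Circle1, a y = y ↔ y = ((0 : ℝ) : Circle1) ∨ y = ((1 / n : ℝ) : Circle1)) ∧
      IsAttractingFixedPt (⇑a) ((1 / n : ℝ) : Circle1) ∧
      IsAttractingFixedPt (⇑a.symm) ((0 : ℝ) : Circle1) := by
  obtain ⟨hn0, hn1⟩ := one_div_natCast_mem_Ioo n hn
  have h0 := pingpongUnit_zero n hn
  have h1 := pingpongUnit_one n hn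
  have hmono := pingpongUnit_strictMono n hn
  let G := floorExtendOrderIso (pingpongUnit n) hmono (pingpongUnit_continuous n hn) h0 h1
  have hG : ∀ x, G (x + 1) = G x + 1 := floorExtend_add_one _
  have hGu : ∀ x ∈ Icc (0 : ℝ) 1, G x = pingpongUnit n x :=
    fun x hx => floorExtend_of_mem_Icc h0 h1 hx
  have hG0 : G 0 = 0 := by rw [hGu 0 ⟨le_rfl, zero_le_one⟩, h0]
  have hGn : G (1 / n) = 1 / n := by
    rw [hGu _ ⟨hn0.le, hn1.le⟩, pingpongUnit_of_le n le_rfl, pongF_one_div n hn]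
  have hlt : ∀ x ∈ Ioo (0 : ℝ) (1 / n), x < G x := fun x hx => by
    rw [hGu x ⟨hx.1.le, (hx.2.trans hn1).le⟩, pingpongUnit_of_le n hx.2.le]
    exact lt_pongF n hn hx.1 hx.2
  have hgt : ∀ x ∈ Ioo (1 / n : ℝ) 1, G x < x := fun x hx => by
    rw [hGu x ⟨(hn0.trans hx.1).le, hx.2.le⟩, pingpongUnit_of_ge n hn hx.1.le]
    exact pongFConj_lt n hn hx.1 hx.2
  have hcoe : ∀ x : ℝ, circleHomeomorph G hG (x : Circle1) = (G x : Circle1) := fun _ => rfl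
  refine ⟨circleHomeomorph G hG, fun x hx0 hx1 => ?_, fun x hx0 hx1 => ?_, fun y => ⟨?_, ?_⟩,
    isAttractingFixedPt_circleHomeomorph G hG hn0 hn1 hGn hlt hgt, ?_⟩
  · rw [hcoe, hGu x ⟨hx0, hx1.trans hn1.le⟩, pingpongUnit_of_le n hx1]
  · rw [hcoe, hGu x ⟨hn0.le.trans hx0, hx1⟩, pingpongUnit_of_ge n hn hx0, pongFConj]
  · intro hy
    obtain ⟨x, hx, rfl⟩ : ∃ x ∈ Ico (0 : ℝ) 1, (x : Circle1) = y := by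
      have := AddCircle.coe_image_Ico_eq (1 : ℝ) 0 ▸ mem_univ y
      simpa using this
    have hGx : G x ∈ Ico (0 : ℝ) 1 := by
      rw [hGu x ⟨hx.1, hx.2.le⟩]
      exact ⟨h0 ▸ hmono.monotone hx.1, h1 ▸ hmono hx.2⟩
    rw [hcoe] at hy
    have hfix : G x = x :=
      (AddCircle.coe_eq_coe_iff_of_mem_Ico (p := (1 : ℝ)) (a := 0)
        (by simpa using hGx) (by simpa using hx)).1 hy
    rcases hx.1.eq_or_lt with rfl | hx0
    · exact Or.inl rfl
    · rcases lt_trichotomy x (1 / n) with h | rfl | h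
      · exact absurd hfix (hlt x ⟨hx0, h⟩).ne'
      · exact Or.inr rfl
      · exact absurd hfix (hgt x ⟨h, hx.2⟩).ne
  · rintro (rfl | rfl)
    · rw [hcoe, hG0]
    · rw [hcoe, hGn]
  · refine isAttractingFixedPt_circleHomeomorph G.symm (G.symm_add_one hG) (p := 1 / n - 1)
      (r := 1 / n) (by linarith) hn0 (by rw [OrderIso.symm_apply_eq, hG0]) (fun x hx => ?_)
      (fun x hx => ?_)
    · rw [G.lt_symm_apply]
      have := hgt (x + 1) ⟨by linarith [hx.1], by linarith [hx.2]⟩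
      rw [hG] at this
      linarith
    · rw [G.symm_apply_lt]
      exact hlt x hx
end
end
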